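/- Assume E satisfies the conditions of the algebraic delocalization theorem (E ∈ [(2c_V/L)^{4/(1+dη)}, min(c_V^{4/(1+dη)}, c₂^{2/(dη)})] with c_V = c₁(1+‖V‖_∞^{1/2})^{−1/2}, η ∈ (0,1/(4−d)), L sufficiently large). Let Ψ_λ be finitely many L²-orthonormal C² solutions of (−Δ+V)Ψ_λ = λΨ_λ on 𝕋^d_L with eigenvalues λ ∈ [E,2E], let h : ℝ → ℝ be continuous with support contained in [E,2E], fix x₀ ∈ 𝕋^d_L with Σ_λ h(λ)² |Ψ_λ(x₀)|² ≠ 0, and let F = Σ_λ h(λ) conj(Ψ_λ(x₀)) Ψ_λ normalized so that ‖F‖_{L²(𝕋^d_L)} = 1, with associated probability measure dμ_h = |F|² dμ. Then for every ball B_ℓ ⊂ 𝕋^d_L of radius ℓ = c_V E^{−1/4+η(1−d/4)} and the concentric ball B_r of radius r = ℓ E^{−η}: either μ_h(B_ℓ) < 1/2 or μ_h(B_r) < 1 − E. -/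

import Mathlib

open MeasureTheory Real Filter

noncomputable section

/-- The `i`-th generator of the lattice `L·ℒ₀ = ℤ(L·e₁) ⊕ ℤ(L·γ₁·e₂) ⊕ ⋯ ⊕ ℤ(L·γ_{d-1}·e_d)`. -/
def latVec (d : ℕ) (L : ℝ) (γ : Fin d → ℝ) (i : Fin d) : EuclideanSpace ℝ (Fin d) :=
  EuclideanSpace.single i (L * γ i)

/-- `f : ℝ^d → α` is periodic with respect to the lattice `L·ℒ₀` (equivalently,
it descends to the torus `𝕋^d_L = ℝ^d / L·ℒ₀`). -/
def LatPeriodic {α : Type*} (d : ℕ) (L : ℝ) (γ : Fin d → ℝ)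
    (f : EuclideanSpace ℝ (Fin d) → α) : Prop :=
  ∀ (x : EuclideanSpace ℝ (Fin d)) (i : Fin d), f (x + latVec d L γ i) = f x

/-- A fundamental domain for the torus `𝕋^d_L = ℝ^d / L·ℒ₀`. -/
def fund (d : ℕ) (L : ℝ) (γ : Fin d → ℝ) : Set (EuclideanSpace ℝ (Fin d)) :=
  {x | ∀ i, x i ∈ Set.Ico (0 : ℝ) (L * γ i)}

/-- The quotient (torus) distance on `𝕋^d_L`, computed between representatives in `ℝ^d`. -/
def torusDist (d : ℕ) (L : ℝ) (γ : Fin d → ℝ)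
    (x y : EuclideanSpace ℝ (Fin d)) : ℝ :=
  ⨅ v : Fin d → ℤ, ‖x - y - ∑ i, (v i : ℝ) • latVec d L γ i‖

/-- The (periodized) open ball `B(x₀, ρ)` of the torus metric, as a subset of `ℝ^d`. -/
def torusBall (d : ℕ) (L : ℝ) (γ : Fin d → ℝ)
    (x₀ : EuclideanSpace ℝ (Fin d)) (ρ : ℝ) : Set (EuclideanSpace ℝ (Fin d)) :=
  {x | torusDist d L γ x x₀ < ρ}

/-- The Euclidean Laplacian `Δf = ∑ᵢ ∂²f/∂xᵢ²`. -/
def lap (d : ℕ) (f : EuclideanSpace ℝ (Fin d) → ℂ)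
    (x : EuclideanSpace ℝ (Fin d)) : ℂ :=
  ∑ i, fderiv ℝ (fun y => fderiv ℝ f y (EuclideanSpace.single i 1)) x
      (EuclideanSpace.single i 1)

/-- The squared norm of the gradient, `|∇f|² = ∑ᵢ |∂f/∂xᵢ|²`. -/
def gradSq (d : ℕ) (f : EuclideanSpace ℝ (Fin d) → ℂ)
    (x : EuclideanSpace ℝ (Fin d)) : ℝ :=
  ∑ i, ‖fderiv ℝ f x (EuclideanSpace.single i 1)‖ ^ 2

/-- An `L²`-normalized solution of the stationary Schrödinger equation
`(-Δ + V)Ψ = EΨ` on the torus `𝕋^d_L`. -/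
def IsSolution (d : ℕ) (L : ℝ) (γ : Fin d → ℝ)
    (V : EuclideanSpace ℝ (Fin d) → ℝ) (E : ℝ)
    (Ψ : EuclideanSpace ℝ (Fin d) → ℂ) : Prop :=
  ContDiff ℝ 2 Ψ ∧ LatPeriodic d L γ Ψ ∧
    (∀ x, -lap d Ψ x + (V x : ℂ) * Ψ x = (E : ℂ) * Ψ x) ∧
    (∫ x in fund d L γ, ‖Ψ x‖ ^ 2) = 1

/-- `r_d(n)`: the number of lattice points `ξ ∈ ℤ^d` with `|ξ|² = n`. -/
def rd (d n : ℕ) : ℕ := Nat.card {ξ : Fin d → ℤ // ∑ i, (ξ i) ^ 2 = (n : ℤ)}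

/-- The character `e(ξ·x/r') = e^{2πi ξ·x/r'}`. -/
def ec (d : ℕ) (r' : ℝ) (ξ : Fin d → ℤ) (x : EuclideanSpace ℝ (Fin d)) : ℂ :=
  Complex.exp (2 * Real.pi * Complex.I * (∑ i, (ξ i : ℂ) * (x i : ℂ)) / (r' : ℂ))

lemma aux_isFD (d : ℕ) (L : ℝ) (γ : Fin d → ℝ) (hP : ∀ i, 0 < L * γ i) :
    ∃ b : Module.Basis (Fin d) ℝ (EuclideanSpace ℝ (Fin d)),
      (∀ i, b i = latVec d L γ i) ∧ ZSpan.fundamentalDomain b = fund d L γ := by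
  have hu : ∀ i, IsUnit (L * γ i) := fun i => (hP i).ne'.isUnit
  refine ⟨(EuclideanSpace.basisFun (Fin d) ℝ).toBasis.isUnitSMul hu, ?_, ?_⟩
  · intro i
    rw [Module.Basis.isUnitSMul_apply]
    ext j
    simp [latVec]
  · ext x
    simp only [ZSpan.mem_fundamentalDomain, fund, Set.mem_ofPred_eq]
    refine forall_congr' fun i => ?_
    rw [Module.Basis.repr_isUnitSMul]
    have : ((hu i).unit⁻¹ • ((EuclideanSpace.basisFun (Fin d) ℝ).toBasis.repr x i) : ℝ)
        = x i / (L * γ i) := by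
      rw [Units.smul_def, smul_eq_mul, Units.val_inv_eq_inv_val, IsUnit.unit_spec]
      simp only [OrthonormalBasis.coe_toBasis_repr_apply, EuclideanSpace.basisFun_repr]
      field_simp
    rw [this]
    simp only [Set.mem_Ico]
    rw [div_lt_one (hP i), le_div_iff₀ (hP i), zero_mul]

lemma aux_fund_meas (d : ℕ) (L : ℝ) (γ : Fin d → ℝ) : MeasurableSet (fund d L γ) := by
  have : fund d L γ = ⋂ i, (fun x : EuclideanSpace ℝ (Fin d) => x i) ⁻¹' Set.Ico 0 (L * γ i) := by
    ext x; simp [fund]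
  rw [this]
  refine MeasurableSet.iInter fun i => ?_
  have : Measurable (fun x : EuclideanSpace ℝ (Fin d) => x i) := by fun_prop
  exact this measurableSet_Ico

lemma aux_fund_cpt (d : ℕ) (L : ℝ) (γ : Fin d → ℝ) (hP : ∀ i, 0 < L * γ i) :
    ∃ K : Set (EuclideanSpace ℝ (Fin d)), IsCompact K ∧ fund d L γ ⊆ K := by
  obtain ⟨b, -, hb⟩ := aux_isFD d L γ hP
  rw [← hb]
  exact ⟨_, (ZSpan.fundamentalDomain_isBounded b).isCompact_closure, subset_closure⟩

lemma aux_int {G : Type*} [NormedAddCommGroup G] (d : ℕ) (L : ℝ) (γ : Fin d → ℝ) (hP : ∀ i, 0 < L * γ i)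
    (f : EuclideanSpace ℝ (Fin d) → G) (hf : Continuous f) :
    IntegrableOn f (fund d L γ) := by
  obtain ⟨K, hK, hs⟩ := aux_fund_cpt d L γ hP
  exact (hf.continuousOn.integrableOn_compact hK).mono_set hs

open Pointwise in
lemma aux_transl (d : ℕ) (L : ℝ) (γ : Fin d → ℝ) (hP : ∀ i, 0 < L * γ i)
    (f : EuclideanSpace ℝ (Fin d) → ℝ) (hf : LatPeriodic d L γ f) (v : EuclideanSpace ℝ (Fin d)) :
    ∫ x in fund d L γ, f (x + v) = ∫ x in fund d L γ, f x := by
  obtain ⟨b, hb1, hb⟩ := aux_isFD d L γ hP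
  have hper : ∀ u ∈ Submodule.span ℤ (Set.range b), ∀ x, f (u + x) = f x := by
    intro u hu
    induction hu using Submodule.span_induction with
    | mem u hu =>
      obtain ⟨i, rfl⟩ := hu
      intro x
      rw [add_comm, hb1, hf]
    | zero => intro x; simp
    | add u w _ _ h1 h2 => intro x; rw [add_assoc, h1, h2]
    | smul a u _ h =>
      intro x
      induction a using Int.induction_on generalizing x with
      | zero => simp
      | succ n ih => rw [add_smul, one_smul, add_assoc, ih, h]
      | pred n ih =>
        rw [← h ((-(n:ℤ) - 1) • u + x), ← add_assoc]
        have h5 : u + (-(n:ℤ) - 1) • u = (-(n:ℤ)) • u := by rw [sub_smul, one_smul]; abel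
        rw [h5, ih]
  have : Countable (Submodule.span ℤ (Set.range b)).toAddSubgroup :=
    inferInstanceAs (Countable (Submodule.span ℤ (Set.range b)))
  have hfd := ZSpan.isAddFundamentalDomain' b (volume : Measure (EuclideanSpace ℝ (Fin d)))
  have hfd2 := hfd.vadd_of_comm v
  have h1 : ∫ x in fund d L γ, f x = ∫ x in v +ᵥ (fund d L γ), f x := by
    rw [← hb]
    refine hfd.setIntegral_eq hfd2 ?_
    intro g x
    exact hper g g.2 x
  rw [h1]
  have h2 : (fun x => x + v) ⁻¹' (v +ᵥ (fund d L γ)) = fund d L γ := by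
    ext x
    simp [Set.mem_vadd_set_iff_neg_vadd_mem, add_comm]
  have := (measurePreserving_add_right (volume : Measure (EuclideanSpace ℝ (Fin d))) v).setIntegral_preimage_emb
    (measurableEmbedding_addRight v) f (v +ᵥ (fund d L γ))
  rw [h2] at this
  exact this

lemma aux_swap (d : ℕ) (L : ℝ) (γ : Fin d → ℝ) (hP : ∀ i, 0 < L * γ i)
    (f : EuclideanSpace ℝ (Fin d) → ℝ) (hf : Continuous f) (hper : LatPeriodic d L γ f)
    (e : EuclideanSpace ℝ (Fin d)) (t : ℝ) (ht : 0 ≤ t) :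
    ∫ x in fund d L γ, (∫ s in (0:ℝ)..t, f (x + s • e)) = t * ∫ x in fund d L γ, f x := by
  simp_rw [intervalIntegral.integral_of_le ht]
  rw [MeasureTheory.integral_integral_swap]
  · simp_rw [aux_transl d L γ hP f hper]
    simp [ht]
  · obtain ⟨K, hK, hs⟩ := aux_fund_cpt d L γ hP
    rw [Measure.prod_restrict]
    have : IntegrableOn (Function.uncurry fun (x : EuclideanSpace ℝ (Fin d)) (s : ℝ) => f (x + s • e))
      (K ×ˢ Set.Icc 0 t) (volume.prod volume) := by
      refine ContinuousOn.integrableOn_compact (hK.prod isCompact_Icc) ?_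
      apply Continuous.continuousOn
      unfold Function.uncurry
      fun_prop
    exact this.mono_set (Set.prod_mono hs Set.Ioc_subset_Icc_self)

lemma aux_per_fderiv {G : Type*} [NormedAddCommGroup G] [NormedSpace ℝ G]
    (d : ℕ) (L : ℝ) (γ : Fin d → ℝ)
    (f : EuclideanSpace ℝ (Fin d) → G) (hper : LatPeriodic d L γ f)
    (e : EuclideanSpace ℝ (Fin d)) : LatPeriodic d L γ (fun x => fderiv ℝ f x e) := by
  intro x i
  have : (fun y => f (y + latVec d L γ i)) = f := by ext y; exact hper y i
  have h2 := fderiv_comp_add_right (𝕜 := ℝ) (f := f) (x := x) (latVec d L γ i)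
  rw [this] at h2
  simp only [h2]

lemma aux_ftc {G : Type*} [NormedAddCommGroup G] [NormedSpace ℝ G] [CompleteSpace G]
    (d : ℕ) (f : EuclideanSpace ℝ (Fin d) → G) (hf : ContDiff ℝ 1 f)
    (e x : EuclideanSpace ℝ (Fin d)) (t : ℝ) :
    ∫ s in (0:ℝ)..t, fderiv ℝ f (x + s • e) e = f (x + t • e) - f x := by
  have hc : Continuous (fun y => fderiv ℝ f y e) :=
    (hf.continuous_fderiv (by norm_num)).clm_apply continuous_const
  have := intervalIntegral.integral_eq_sub_of_hasDerivAt (a := 0) (b := t)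
    (f := fun s : ℝ => f (x + s • e)) (f' := fun s => fderiv ℝ f (x + s • e) e) ?_ ?_
  · simpa using this
  · intro s _
    have h1 : HasFDerivAt f (fderiv ℝ f (x + s • e)) (x + s • e) :=
      (hf.differentiable (by norm_num) _).hasFDerivAt
    have h2 : HasDerivAt (fun s : ℝ => x + s • e) e s := by
      simpa using ((hasDerivAt_id s).smul_const e).const_add x
    exact h1.comp_hasDerivAt s h2
  · apply Continuous.intervalIntegrable
    exact hc.comp (by fun_prop)

lemma aux_int_deriv (d : ℕ) (L : ℝ) (γ : Fin d → ℝ) (hP : ∀ i, 0 < L * γ i)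
    (g : EuclideanSpace ℝ (Fin d) → ℝ) (hg : ContDiff ℝ 1 g) (hper : LatPeriodic d L γ g)
    (i : Fin d) : ∫ x in fund d L γ, fderiv ℝ g x (EuclideanSpace.single i 1) = 0 := by
  have hc : Continuous (fun y => fderiv ℝ g y (EuclideanSpace.single i 1)) :=
    (hg.continuous_fderiv (by norm_num)).clm_apply continuous_const
  have h := aux_swap d L γ hP _ hc (aux_per_fderiv d L γ g hper _) (EuclideanSpace.single i 1)
    (L * γ i) (hP i).le
  simp_rw [aux_ftc d g hg] at h
  have : ∀ x, g (x + (L * γ i) • EuclideanSpace.single i 1) - g x = 0 := by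
    intro x
    have := hper x i
    have h3 : latVec d L γ i = (L * γ i) • EuclideanSpace.single i 1 := by
      ext j; simp [latVec]
    rw [← h3, this, sub_self]
  simp_rw [this] at h
  simp only [integral_zero] at h
  rcases mul_eq_zero.1 h.symm with h | h
  · exact absurd h (hP i).ne'
  · exact h

lemma aux_cs (u : ℝ → ℂ) (hu : Continuous u) (t : ℝ) (ht : 0 ≤ t) :
    ‖∫ s in (0:ℝ)..t, u s‖ ^ 2 ≤ t * ∫ s in (0:ℝ)..t, ‖u s‖ ^ 2 := by
  rcases ht.eq_or_lt with rfl | ht'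
  · simp
  set I := ∫ s in (0:ℝ)..t, ‖u s‖ with hI
  have h1 : ‖∫ s in (0:ℝ)..t, u s‖ ≤ I := intervalIntegral.norm_integral_le_integral_norm ht
  have h2 : 0 ≤ ∫ s in (0:ℝ)..t, (‖u s‖ - I / t) ^ 2 :=
    intervalIntegral.integral_nonneg ht fun s _ => sq_nonneg _
  have h3 : ∫ s in (0:ℝ)..t, (‖u s‖ - I / t) ^ 2 =
      (∫ s in (0:ℝ)..t, ‖u s‖ ^ 2) - 2 * (I / t) * I + t * (I / t) ^ 2 := by
    have : ∀ s, (‖u s‖ - I / t) ^ 2 = ‖u s‖ ^ 2 - 2 * (I / t) * ‖u s‖ + (I / t) ^ 2 := by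
      intro s; ring
    simp_rw [this]
    rw [intervalIntegral.integral_add, intervalIntegral.integral_sub,
      intervalIntegral.integral_const_mul, intervalIntegral.integral_const]
    · simp [hI]
    all_goals exact Continuous.intervalIntegrable (by fun_prop) _ _
  rw [h3] at h2
  have h4 : I ^ 2 ≤ t * ∫ s in (0:ℝ)..t, ‖u s‖ ^ 2 := by
    have h5 : t * ((∫ s in (0:ℝ)..t, ‖u s‖ ^ 2) - 2 * (I / t) * I + t * (I / t) ^ 2)
      = t * (∫ s in (0:ℝ)..t, ‖u s‖ ^ 2) - I ^ 2 := by field_simp; ring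
    have := mul_nonneg ht h2
    linarith
  exact (pow_le_pow_left₀ (norm_nonneg _) h1 2).trans h4

lemma aux_shift (d : ℕ) (L : ℝ) (γ : Fin d → ℝ) (hP : ∀ i, 0 < L * γ i)
    (F : EuclideanSpace ℝ (Fin d) → ℂ) (hF : ContDiff ℝ 1 F) (hper : LatPeriodic d L γ F)
    (e : EuclideanSpace ℝ (Fin d)) (t : ℝ) (ht : 0 ≤ t) :
    ∫ x in fund d L γ, ‖F (x + t • e) - F x‖ ^ 2 ≤
      t ^ 2 * ∫ x in fund d L γ, ‖fderiv ℝ F x e‖ ^ 2 := by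
  have hc : Continuous (fun y => fderiv ℝ F y e) :=
    (hF.continuous_fderiv (by norm_num)).clm_apply continuous_const
  have hp := aux_per_fderiv d L γ F hper e
  have h := aux_swap d L γ hP (fun x => ‖fderiv ℝ F x e‖ ^ 2) (by fun_prop)
    (fun x i => by simp only [hp x i]) e t ht
  have hFc := hF.continuous
  have : t ^ 2 * ∫ x in fund d L γ, ‖fderiv ℝ F x e‖ ^ 2
      = ∫ x in fund d L γ, t * (∫ s in (0:ℝ)..t, ‖fderiv ℝ F (x + s • e) e‖ ^ 2) := by
    rw [integral_const_mul, h]; ring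
  rw [this]
  refine setIntegral_mono (aux_int d L γ hP _ (by fun_prop)) (aux_int d L γ hP _ ?_) ?_
  · refine continuous_const.mul ?_
    refine intervalIntegral.continuous_parametric_intervalIntegral_of_continuous' ?_ _ _
    unfold Function.uncurry
    have : Continuous (fun p : EuclideanSpace ℝ (Fin d) × ℝ => p.1 + p.2 • e) := by fun_prop
    exact ((hc.comp this).norm.pow 2)
  · intro x
    simp only
    rw [← aux_ftc d F hF]
    exact aux_cs (fun s => fderiv ℝ F (x + s • e) e) (hc.comp (by fun_prop)) t ht

lemma aux_energy (d : ℕ) (L : ℝ) (γ : Fin d → ℝ) (hP : ∀ i, 0 < L * γ i)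
    (F G : EuclideanSpace ℝ (Fin d) → ℂ) (V : EuclideanSpace ℝ (Fin d) → ℝ)
    (hF : ContDiff ℝ 2 F) (hper : LatPeriodic d L γ F) (hG : Continuous G) (hV : ∀ x, 0 ≤ V x)
    (heq : ∀ x, -lap d F x + (V x : ℂ) * F x = G x) (i₀ : Fin d) :
    ∫ x in fund d L γ, ‖fderiv ℝ F x (EuclideanSpace.single i₀ 1)‖ ^ 2 ≤
      ∫ x in fund d L γ, (G x * (starRingEnd ℂ) (F x)).re := by
  have hFc := hF.continuous
  have hF1 : ContDiff ℝ 1 F := hF.of_le (by norm_num)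
  have hD : ∀ i, ContDiff ℝ 1 (fun y => fderiv ℝ F y (EuclideanSpace.single i 1)) := fun i =>
    (hF.fderiv_right (m := 1) (by norm_num)).clm_apply contDiff_const
  have hDc := fun i => (hD i).continuous
  have hg : ∀ i, ContDiff ℝ 1
      (fun y => inner ℝ (F y) (fderiv ℝ F y (EuclideanSpace.single i 1))) := fun i =>
    hF1.inner ℝ (hD i)
  have hgp : ∀ i, LatPeriodic d L γ
      (fun y => inner ℝ (F y) (fderiv ℝ F y (EuclideanSpace.single i 1))) := by
    intro i x k
    have := aux_per_fderiv d L γ F hper (EuclideanSpace.single i 1) x k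
    simp only at this ⊢
    rw [this, hper]
  have hgc : ∀ i, Continuous (fun x => fderiv ℝ
      (fun y => inner ℝ (F y) (fderiv ℝ F y (EuclideanSpace.single i 1))) x
        (EuclideanSpace.single i 1)) := fun i =>
    ((hg i).continuous_fderiv (by norm_num)).clm_apply continuous_const
  have h0 : ∫ x in fund d L γ, ∑ i, fderiv ℝ
      (fun y => inner ℝ (F y) (fderiv ℝ F y (EuclideanSpace.single i 1))) x
        (EuclideanSpace.single i 1) = 0 := by
    rw [integral_finsetSum]
    · exact Finset.sum_eq_zero fun i _ => aux_int_deriv d L γ hP _ (hg i) (hgp i) i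
    · intro i _
      exact aux_int d L γ hP _ (hgc i)
  have hGc : Continuous (fun x => (G x * (starRingEnd ℂ) (F x)).re) :=
    Complex.continuous_re.comp (hG.mul (Complex.continuous_conj.comp hFc))
  rw [← zero_add (∫ x in fund d L γ, (G x * (starRingEnd ℂ) (F x)).re), ← h0, ← integral_add
    (aux_int d L γ hP _ (continuous_finsetSum _ fun i _ => hgc i)) (aux_int d L γ hP _ hGc)]
  refine setIntegral_mono (aux_int d L γ hP _ ((hDc i₀).norm.pow 2))
    (aux_int d L γ hP _ ((continuous_finsetSum _ fun i _ => hgc i).add hGc)) ?_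
  intro x
  simp only
  have h1 : ∀ i, fderiv ℝ
      (fun y => inner ℝ (F y) (fderiv ℝ F y (EuclideanSpace.single i 1))) x
        (EuclideanSpace.single i 1) =
      inner ℝ (F x) (fderiv ℝ (fun y => fderiv ℝ F y (EuclideanSpace.single i 1)) x
        (EuclideanSpace.single i 1)) + ‖fderiv ℝ F x (EuclideanSpace.single i 1)‖ ^ 2 := by
    intro i
    rw [fderiv_inner_apply ℝ (hF1.differentiable (by norm_num) x)
      ((hD i).differentiable (by norm_num) x), real_inner_self_eq_norm_sq]
  simp_rw [h1]
  rw [Finset.sum_add_distrib, ← inner_sum]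
  have h2 : ‖fderiv ℝ F x (EuclideanSpace.single i₀ 1)‖ ^ 2 ≤
      ∑ i, ‖fderiv ℝ F x (EuclideanSpace.single i 1)‖ ^ 2 :=
    Finset.single_le_sum (f := fun i => ‖fderiv ℝ F x (EuclideanSpace.single i 1)‖ ^ 2)
      (fun i _ => sq_nonneg _) (Finset.mem_univ i₀)
  have h3 : 0 ≤ inner ℝ (F x) (lap d F x) + (G x * (starRingEnd ℂ) (F x)).re := by
    rw [← heq x, Complex.inner]
    have : ((starRingEnd ℂ) (F x) * lap d F x).re +
      ((-lap d F x + (V x : ℂ) * F x) * (starRingEnd ℂ) (F x)).re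
      = V x * Complex.normSq (F x) := by
      simp [Complex.normSq_apply]; ring
    first
    | rw [this]
    | (have h4 : lap d F x * (starRingEnd ℂ) (F x) = (starRingEnd ℂ) (F x) * lap d F x := mul_comm _ _
       rw [h4, this])
    exact mul_nonneg (hV x) (Complex.normSq_nonneg _)
  unfold lap at h3
  linarith

lemma aux_orth (d : ℕ) (L : ℝ) (γ : Fin d → ℝ) (hP : ∀ i, 0 < L * γ i)
    (n : ℕ) (Ψ : Fin n → EuclideanSpace ℝ (Fin d) → ℂ) (hΨ : ∀ j, Continuous (Ψ j))
    (ho : ∀ j k, (∫ x in fund d L γ, Ψ j x * (starRingEnd ℂ) (Ψ k x)) =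
          if j = k then 1 else 0) (a b : Fin n → ℂ) :
    ∫ x in fund d L γ, ((∑ j, b j * Ψ j x) * (starRingEnd ℂ) (∑ j, a j * Ψ j x)).re =
      (∑ j, b j * (starRingEnd ℂ) (a j)).re := by
  have hc : ∀ j k, Continuous (fun x => Ψ j x * (starRingEnd ℂ) (Ψ k x)) := fun j k =>
    (hΨ j).mul (Complex.continuous_conj.comp (hΨ k))
  have h1 : ∀ x, (∑ j, b j * Ψ j x) * (starRingEnd ℂ) (∑ j, a j * Ψ j x) =
      ∑ j, ∑ k, (b j * (starRingEnd ℂ) (a k)) * (Ψ j x * (starRingEnd ℂ) (Ψ k x)) := by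
    intro x
    rw [map_sum, Finset.sum_mul_sum]
    refine Finset.sum_congr rfl fun j _ => Finset.sum_congr rfl fun k _ => ?_
    rw [map_mul]; ring
  simp_rw [h1]
  have hi : ∀ j k, IntegrableOn (fun x => (b j * (starRingEnd ℂ) (a k)) *
      (Ψ j x * (starRingEnd ℂ) (Ψ k x))) (fund d L γ) := fun j k =>
    aux_int d L γ hP _ (continuous_const.mul (hc j k))
  have h2 : ∫ x in fund d L γ, ∑ j, ∑ k, (b j * (starRingEnd ℂ) (a k)) *
      (Ψ j x * (starRingEnd ℂ) (Ψ k x)) = ∑ j, b j * (starRingEnd ℂ) (a j) := by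
    rw [integral_finsetSum _ (fun j _ => integrable_finsetSum _ fun k _ => hi j k)]
    refine Finset.sum_congr rfl fun j _ => ?_
    rw [integral_finsetSum _ (fun k _ => hi j k)]
    simp_rw [integral_const_mul, ho]
    simp
  rw [← h2]
  exact integral_re (𝕜 := ℂ) (integrable_finsetSum _ fun j _ => integrable_finsetSum _ fun k _ => hi j k)

lemma aux_slab (d : ℕ) (L : ℝ) (γ : Fin d → ℝ) (hP : ∀ i, 0 < L * γ i)
    (F : EuclideanSpace ℝ (Fin d) → ℂ) (hF : ContDiff ℝ 1 F) (hper : LatPeriodic d L γ F)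
    (i : Fin d) (c ℓ : ℝ) (hℓ : 0 < ℓ) (hℓ2 : 16 * ℓ ≤ L * γ i)
    (T : Set (EuclideanSpace ℝ (Fin d)))
    (hT : T = {x | ∃ m : ℤ, |x i - c - m * (L * γ i)| < ℓ}) :
    ∫ x in fund d L γ ∩ T, ‖F x‖ ^ 2 ≤ 1 / 4 * (∫ x in fund d L γ, ‖F x‖ ^ 2) +
      2 * (14 * ℓ) ^ 2 *
        ∫ x in fund d L γ, ‖fderiv ℝ F x (EuclideanSpace.single i 1)‖ ^ 2 := by
  set e : EuclideanSpace ℝ (Fin d) := EuclideanSpace.single i 1 with he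
  set P := L * γ i with hPdef
  have hmem : ∀ x, x ∈ T ↔ ∃ m : ℤ, |x i - c - m * P| < ℓ := by
    intro x; rw [hT]; rfl
  have hTo : IsOpen T := by
    have : T = ⋃ m : ℤ, {x | |x i - c - m * P| < ℓ} := by
      ext x; rw [hmem]; simp
    rw [this]
    exact isOpen_iUnion fun m => isOpen_lt (by fun_prop) continuous_const
  have hTm := hTo.measurableSet
  have hTp : ∀ x k, x + latVec d L γ k ∈ T ↔ x ∈ T := by
    intro x k
    rw [hmem, hmem]
    by_cases hk : i = k
    · subst hk
      have : (x + latVec d L γ i) i = x i + P := by simp [latVec, hPdef]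
      rw [this]
      constructor
      · rintro ⟨m, hm⟩
        refine ⟨m - 1, ?_⟩
        convert hm using 2
        push_cast; ring
      · rintro ⟨m, hm⟩
        refine ⟨m + 1, ?_⟩
        convert hm using 2
        push_cast; ring
    · have : (x + latVec d L γ k) i = x i := by simp [latVec, hk]
      rw [this]
  have hFc := hF.continuous
  set M := ∫ x in fund d L γ, ‖F x‖ ^ 2 with hM
  set D := ∫ x in fund d L γ, ‖fderiv ℝ F x e‖ ^ 2 with hD
  have hD0 : 0 ≤ D := integral_nonneg fun x => sq_nonneg _
  set A := ∫ x in fund d L γ ∩ T, ‖F x‖ ^ 2 with hA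
  have hA' : A = ∫ x in fund d L γ, T.indicator (fun x => ‖F x‖ ^ 2) x := by
    rw [setIntegral_indicator hTm]
  have hNF : IntegrableOn (fun x => ‖F x‖ ^ 2) (fund d L γ) := aux_int d L γ hP _ (by fun_prop)
  -- indicator of shifted set
  let S : ℝ → Set (EuclideanSpace ℝ (Fin d)) := fun t => {y | y - t • e ∈ T}
  have hSm : ∀ t, MeasurableSet (S t) := fun t => by
    have : Measurable (fun y : EuclideanSpace ℝ (Fin d) => y - t • e) := by fun_prop
    exact this hTm
  have key : ∀ k : Fin 8, A ≤ 2 * (∫ x in fund d L γ, (S (2 * k * ℓ)).indicator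
      (fun x => ‖F x‖ ^ 2) x) + 2 * ((14 * ℓ) ^ 2 * D) := by
    intro k
    set t : ℝ := 2 * k * ℓ with ht
    have ht0 : 0 ≤ t := by positivity
    have hk : (k : ℝ) ≤ 7 := by exact_mod_cast (Nat.lt_succ_iff.1 k.2)
    have ht1 : t ≤ 14 * ℓ := by rw [ht]; nlinarith
    have h1 := aux_shift d L γ hP F hF hper e t ht0
    have h2 : t ^ 2 * D ≤ (14 * ℓ) ^ 2 * D :=
      mul_le_mul_of_nonneg_right (pow_le_pow_left₀ ht0 ht1 2) hD0
    have h3 : ∫ x in fund d L γ, (S t).indicator (fun x => ‖F x‖ ^ 2) x =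
        ∫ x in fund d L γ, T.indicator (fun x => ‖F (x + t • e)‖ ^ 2) x := by
      rw [← aux_transl d L γ hP (fun x => (S t).indicator (fun x => ‖F x‖ ^ 2) x) ?_ (t • e)]
      · refine integral_congr_ae (Eventually.of_forall fun x => ?_)
        by_cases hx : x ∈ T
        · have : x + t • e ∈ S t := by simpa [S] using hx
          simp [hx, this]
        · have : x + t • e ∉ S t := by simpa [S] using hx
          simp [hx, this]
      · intro x k
        have : x + latVec d L γ k ∈ S t ↔ x ∈ S t := by
          change x + latVec d L γ k - t • e ∈ T ↔ x - t • e ∈ T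
          rw [← hTp (x - t • e) k, add_sub_right_comm]
        by_cases hx : x ∈ S t
        · simp [hx, this.2 hx, hper x k]
        · simp [hx, mt this.1 hx]
    have hi1 : IntegrableOn (T.indicator (fun x => ‖F x‖ ^ 2)) (fund d L γ) := hNF.indicator hTm
    have hi2 : IntegrableOn (T.indicator (fun x => ‖F (x + t • e)‖ ^ 2)) (fund d L γ) :=
      (aux_int d L γ hP (fun x => ‖F (x + t • e)‖ ^ 2) (by fun_prop)).indicator hTm
    have hi3 : IntegrableOn (fun x => ‖F (x + t • e) - F x‖ ^ 2) (fund d L γ) :=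
      aux_int d L γ hP _ (by fun_prop)
    have h4 : A ≤ 2 * (∫ x in fund d L γ, T.indicator (fun x => ‖F (x + t • e)‖ ^ 2) x) +
        2 * ∫ x in fund d L γ, ‖F (x + t • e) - F x‖ ^ 2 := by
      rw [hA', ← integral_const_mul, ← integral_const_mul,
        ← integral_add (hi2.const_mul 2) (hi3.const_mul 2)]
      refine setIntegral_mono hi1 ((hi2.const_mul 2).add (hi3.const_mul 2)) fun x => ?_
      simp only
      by_cases hx : x ∈ T
      · simp only [hx, Set.indicator_of_mem]
        have h5 : ‖F x‖ ≤ ‖F (x + t • e)‖ + ‖F (x + t • e) - F x‖ := by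
          have := norm_sub_le (F (x + t • e)) (F (x + t • e) - F x)
          simpa using this
        have h6 := pow_le_pow_left₀ (norm_nonneg _) h5 2
        nlinarith [sq_nonneg (‖F (x + t • e)‖ - ‖F (x + t • e) - F x‖)]
      · simp only [hx, not_false_eq_true, Set.indicator_of_notMem]
        positivity
    rw [h3]
    linarith
  have hsum : ∑ k : Fin 8, (∫ x in fund d L γ, (S (2 * k * ℓ)).indicator
      (fun x => ‖F x‖ ^ 2) x) ≤ M := by
    rw [← integral_finsetSum _ (fun k _ => hNF.indicator (hSm _))]
    refine setIntegral_mono (integrable_finsetSum _ (fun k _ => hNF.indicator (hSm _))) hNF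
      fun x => ?_
    simp only
    by_cases hx : ∃ k : Fin 8, x ∈ S (2 * k * ℓ)
    · obtain ⟨k, hk⟩ := hx
      rw [Finset.sum_eq_single k]
      · exact Set.indicator_le_self' (fun _ _ => sq_nonneg _) x
      · intro j _ hj
        apply Set.indicator_of_notMem
        intro hj2
        obtain ⟨m, hm⟩ := (hmem _).1 hk
        obtain ⟨m', hm'⟩ := (hmem _).1 hj2
        have e1 : ∀ t : ℝ, (x - t • e) i = x i - t := by intro t; simp [he]
        rw [e1] at hm hm'
        have hlt : |2 * ((j : ℝ) - k) * ℓ - (m - m' : ℤ) * P| < 2 * ℓ := by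
          have := abs_sub (x i - 2 * (k:ℝ) * ℓ - c - m * P) (x i - 2 * (j:ℝ) * ℓ - c - m' * P)
          have h7 : (x i - 2 * (k:ℝ) * ℓ - c - m * P) - (x i - 2 * (j:ℝ) * ℓ - c - m' * P)
            = 2 * ((j : ℝ) - k) * ℓ - (m - m' : ℤ) * P := by push_cast; ring
          rw [h7] at this
          linarith
        generalize m - m' = q at hlt
        have hjk : ∃ z : ℤ, (z : ℝ) = (j : ℝ) - k ∧ z ≠ 0 ∧ -7 ≤ z ∧ z ≤ 7 := by
          refine ⟨(j : ℤ) - k, by push_cast; rfl, ?_, ?_, ?_⟩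
          · intro h; apply hj; ext; omega
          · omega
          · omega
        obtain ⟨z, hz, hz0, hz1, hz2⟩ := hjk
        rw [← hz, abs_lt] at hlt
        have hz1' : (-7:ℝ) ≤ z := by exact_mod_cast hz1
        have hz2' : (z:ℝ) ≤ 7 := by exact_mod_cast hz2
        rcases lt_trichotomy q 0 with hq | hq | hq
        · have : (q:ℝ) ≤ -1 := by exact_mod_cast (by omega : q ≤ -1)
          nlinarith
        · subst hq
          rcases lt_or_gt_of_ne hz0 with h | h
          · have : (z:ℝ) ≤ -1 := by exact_mod_cast (by omega : z ≤ -1)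
            push_cast at hlt
            nlinarith
          · have : (1:ℝ) ≤ z := by exact_mod_cast (by omega : 1 ≤ z)
            push_cast at hlt
            nlinarith
        · have : (1:ℝ) ≤ q := by exact_mod_cast (by omega : 1 ≤ q)
          nlinarith
      · simp
    · push Not at hx
      rw [Finset.sum_eq_zero fun k _ => Set.indicator_of_notMem (hx k) _]
      positivity
  have hfin := Finset.sum_le_sum fun (k : Fin 8) (_ : k ∈ Finset.univ) => key k
  rw [Finset.sum_add_distrib, ← Finset.mul_sum] at hfin
  simp only [Finset.sum_const, Finset.card_univ, Fintype.card_fin, nsmul_eq_mul] at hfin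
  push_cast at hfin
  linarith

lemma aux_ball_sub (d : ℕ) (L : ℝ) (γ : Fin d → ℝ) (i : Fin d) (xc : EuclideanSpace ℝ (Fin d))
    (ℓ : ℝ) : torusBall d L γ xc ℓ ⊆ {x | ∃ m : ℤ, |x i - xc i - m * (L * γ i)| < ℓ} := by
  intro x hx
  obtain ⟨v, hv⟩ := exists_lt_of_ciInf_lt (show torusDist d L γ x xc < ℓ from hx)
  refine ⟨v i, lt_of_le_of_lt ?_ hv⟩
  have := PiLp.norm_apply_le (x - xc - ∑ k, (v k : ℝ) • latVec d L γ k) i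
  refine le_trans (le_of_eq ?_) this
  rw [Real.norm_eq_abs]
  congr 1
  simp [latVec, Pi.single_apply]

lemma aux_lap_sum (d n : ℕ) (Ψ : Fin n → EuclideanSpace ℝ (Fin d) → ℂ)
    (hΨ : ∀ j, ContDiff ℝ 2 (Ψ j)) (a : Fin n → ℂ) (x : EuclideanSpace ℝ (Fin d)) :
    lap d (fun x => ∑ j, a j * Ψ j x) x = ∑ j, a j * lap d (Ψ j) x := by
  unfold lap
  have h1 : ∀ i : Fin d, (fun y => fderiv ℝ (fun x => ∑ j, a j * Ψ j x) y (EuclideanSpace.single i 1))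
      = fun y => ∑ j, a j * fderiv ℝ (Ψ j) y (EuclideanSpace.single i 1) := by
    intro i
    ext y
    rw [fderiv_fun_sum fun j _ => ((hΨ j).differentiable (by norm_num) y).const_mul (a j)]
    rw [ContinuousLinearMap.sum_apply]
    refine Finset.sum_congr rfl fun j _ => ?_
    rw [fderiv_const_mul ((hΨ j).differentiable (by norm_num) y)]
    simp
  simp_rw [h1, Finset.mul_sum]
  rw [Finset.sum_comm]
  refine Finset.sum_congr rfl fun i _ => ?_
  have hD : ∀ j, Differentiable ℝ (fun y => fderiv ℝ (Ψ j) y (EuclideanSpace.single i 1)) := fun j =>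
    (((hΨ j).fderiv_right (m := 1) (by norm_num)).clm_apply contDiff_const).differentiable (by norm_num)
  rw [fderiv_fun_sum fun j _ => (hD j x).const_mul (a j)]
  rw [ContinuousLinearMap.sum_apply]
  refine Finset.sum_congr rfl fun j _ => ?_
  rw [fderiv_const_mul (hD j x)]
  simp

lemma aux_consts (d : ℕ) (hd : 0 < d) (hd3 : d ≤ 3) (η : ℝ) (hη : 0 < η) (cV L E : ℝ)
    (hcV : 0 < cV) (hcV1 : cV ≤ 1 / 100) (hL : 0 < L) (hE : 0 < E) (hE1 : E < 1)
    (h1 : (2 * cV / L) ^ ((4:ℝ) / (1 + d * η)) ≤ E)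
    (h2 : E ≤ ((1:ℝ) / 64) ^ ((2:ℝ) / (d * η))) (ℓ : ℝ)
    (hℓ : ℓ = cV * E ^ (-(1:ℝ)/4 + η * (1 - (d:ℝ)/4))) :
    0 < ℓ ∧ 16 * ℓ ≤ L ∧ ℓ ^ 2 * E ≤ 1 / 10000 := by
  have hd' : (0:ℝ) < d := by exact_mod_cast hd
  have hd3' : (d:ℝ) ≤ 3 := by exact_mod_cast hd3
  have hq : 0 < 1 + d * η := by positivity
  have hdη : 0 < d * η := by positivity
  refine ⟨by rw [hℓ]; positivity, ?_, ?_⟩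
  · have hA : 2 * cV / L ≤ E ^ ((1 + d * η) / 4) := by
      have := Real.rpow_le_rpow (by positivity) h1 (show 0 ≤ (1 + d * η) / 4 by positivity)
      rw [← Real.rpow_mul (by positivity)] at this
      have h3 : (4:ℝ) / (1 + d * η) * ((1 + d * η) / 4) = 1 := by field_simp
      rwa [h3, Real.rpow_one] at this
    have hB : E ^ η ≤ 1 / 16 := by
      have := Real.rpow_le_rpow hE.le h2 hη.le
      rw [← Real.rpow_mul (by positivity)] at this
      have h3 : (2:ℝ) / (d * η) * η = 2 / d := by field_simp
      rw [h3] at this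
      refine this.trans ?_
      have h4 : ((1:ℝ)/64) ^ ((2:ℝ) / d) ≤ ((1:ℝ)/64) ^ ((2:ℝ) / 3) :=
        Real.rpow_le_rpow_of_exponent_ge (by norm_num) (by norm_num)
          (div_le_div_of_nonneg_left (by norm_num) hd' hd3')
      refine h4.trans (le_of_eq ?_)
      rw [show ((1:ℝ)/64) = (1/4) ^ (3:ℝ) by norm_num, ← Real.rpow_mul (by norm_num)]
      norm_num
    have hC : ℓ * E ^ ((1 + d * η) / 4) = cV * E ^ η := by
      rw [hℓ, mul_assoc, ← Real.rpow_add hE]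
      congr 2
      ring
    rw [div_le_iff₀ hL] at hA
    have hpos : 0 < E ^ ((1 + d * η) / 4) := by positivity
    have : 16 * ℓ * E ^ ((1 + d * η) / 4) ≤ L * E ^ ((1 + d * η) / 4) := by nlinarith
    exact le_of_mul_le_mul_right this hpos
  · have : ℓ ^ 2 * E = cV ^ 2 * E ^ ((1:ℝ)/2 + 2 * η * (1 - d / 4)) := by
      rw [hℓ, mul_pow, mul_assoc]
      congr 1
      rw [← Real.rpow_natCast, ← Real.rpow_mul hE.le]
      nth_rewrite 2 [← Real.rpow_one E]
      rw [← Real.rpow_add hE]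
      congr 1
      push_cast
      ring
    rw [this]
    have h5 : E ^ ((1:ℝ)/2 + 2 * η * (1 - d / 4)) ≤ 1 := by
      apply Real.rpow_le_one hE.le hE1.le
      have : 0 ≤ 1 - (d:ℝ)/4 := by linarith
      positivity
    have h6 : 0 ≤ E ^ ((1:ℝ)/2 + 2 * η * (1 - d / 4)) := by positivity
    have h7 : cV ^ 2 ≤ 1 / 10000 := by nlinarith
    nlinarith [sq_nonneg cV]

/-- **Algebraic delocalization for spectral projectors** (Theorem 2.2): with the constants
and energy conditions of the algebraic delocalization theorem, for a finite orthonormal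
family of eigenfunctions with eigenvalues in `[E, 2E]`, `h` continuous supported in `[E,2E]`,
and `F = N^{-1/2} ∑_λ h(λ) conj(Ψ_λ(x₀)) Ψ_λ` (so `‖F‖_{L²} = 1`), every ball `B_ℓ` of radius
`ℓ = c_V E^{-1/4+η(1-d/4)}` and concentric ball `B_r` of radius `r = ℓ E^{-η}` satisfy
`μ_h(B_ℓ) < 1/2` or `μ_h(B_r) < 1 - E`, where `dμ_h = |F|² dμ`. -/
theorem algebraic_delocalization_spectral_projector :
    ∃ c₁ c₂ : ℝ, 0 < c₁ ∧ 0 < c₂ ∧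
      ∀ (d : ℕ) (hd : 0 < d), d ≤ 3 →
      ∀ γ : Fin d → ℝ, (∀ i, 1 ≤ γ i) → γ ⟨0, hd⟩ = 1 →
      ∀ η : ℝ, 0 < η → η < 1 / (4 - (d : ℝ)) →
      ∀ Vsup : ℝ, 0 ≤ Vsup →
      ∀ cV : ℝ, cV = c₁ * (1 + Vsup ^ ((1:ℝ)/2)) ^ (-(1:ℝ)/2) →
      ∃ L₀ : ℝ, 0 < L₀ ∧ ∀ L : ℝ, L₀ ≤ L →
      ∀ V : EuclideanSpace ℝ (Fin d) → ℝ,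
        Measurable V → (∀ x, 0 ≤ V x) → (∀ x, V x ≤ Vsup) → LatPeriodic d L γ V →
      ∀ E : ℝ, 0 < E → E < 1 →
        (2 * cV / L) ^ ((4:ℝ) / (1 + d * η)) ≤ E →
        E ≤ min (cV ^ ((4:ℝ) / (1 + d * η))) (c₂ ^ ((2:ℝ) / (d * η))) →
      ∀ (n : ℕ) (Ψ : Fin n → EuclideanSpace ℝ (Fin d) → ℂ) (lam : Fin n → ℝ),
        (∀ j, ContDiff ℝ 2 (Ψ j)) → (∀ j, LatPeriodic d L γ (Ψ j)) →
        (∀ j x, -lap d (Ψ j) x + (V x : ℂ) * Ψ j x = (lam j : ℂ) * Ψ j x) →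
        (∀ j, lam j ∈ Set.Icc E (2 * E)) →
        (∀ j k, (∫ x in fund d L γ, Ψ j x * (starRingEnd ℂ) (Ψ k x)) =
          if j = k then 1 else 0) →
      ∀ h : ℝ → ℝ, Continuous h → Function.support h ⊆ Set.Icc E (2 * E) →
      ∀ x₀ : EuclideanSpace ℝ (Fin d),
      ∀ N : ℝ, N = ∑ j, (h (lam j)) ^ 2 * ‖Ψ j x₀‖ ^ 2 → N ≠ 0 →
      ∀ F : EuclideanSpace ℝ (Fin d) → ℂ,
        (∀ x, F x = ((N ^ (-(1:ℝ)/2) : ℝ) : ℂ) *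
          ∑ j, (h (lam j) : ℂ) * (starRingEnd ℂ) (Ψ j x₀) * Ψ j x) →
      ∀ xc : EuclideanSpace ℝ (Fin d),
        (∫ x in fund d L γ ∩
            torusBall d L γ xc (cV * E ^ (-(1:ℝ)/4 + η * (1 - (d:ℝ)/4))),
            ‖F x‖ ^ 2) < 1 / 2 ∨
        (∫ x in fund d L γ ∩
            torusBall d L γ xc (cV * E ^ (-(1:ℝ)/4 + η * (1 - (d:ℝ)/4)) * E ^ (-η)),
            ‖F x‖ ^ 2) < 1 - E := by
  refine ⟨1 / 100, 1 / 64, by norm_num, by norm_num, ?_⟩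
  intro d hd hd3 γ hγ hγ0 η hη hη2 Vsup hVsup cV hcV
  refine ⟨1, one_pos, ?_⟩
  intro L hL V _ hV0 _ _ E hE hE1 hEL hEU n Ψ lam hΨ hΨp heq hlam ho h _ _ x₀ N hN hN0 F hF xc
  left
  have hL0 : 0 < L := by linarith
  have hP : ∀ i, 0 < L * γ i := fun i => mul_pos hL0 (by linarith [hγ i])
  have hbase : 1 ≤ 1 + Vsup ^ ((1:ℝ)/2) := by
    have : 0 ≤ Vsup ^ ((1:ℝ)/2) := by positivity
    linarith
  have hcV0 : 0 < cV := by rw [hcV]; positivity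
  have hcV1 : cV ≤ 1 / 100 := by
    rw [hcV]
    have := Real.rpow_le_one_of_one_le_of_nonpos hbase (show (-(1:ℝ)/2) ≤ 0 by norm_num)
    linarith
  obtain ⟨hℓ0, hℓ1, hℓ2⟩ := aux_consts d hd hd3 η hη cV L E hcV0 hcV1 hL0 hE hE1 hEL
    (hEU.trans (min_le_right _ _)) _ rfl
  set ℓ := cV * E ^ (-(1:ℝ)/4 + η * (1 - (d:ℝ)/4)) with hℓ
  have hNpos : 0 < N := by
    refine lt_of_le_of_ne ?_ hN0.symm
    rw [hN]; positivity
  set a : Fin n → ℂ := fun j => ((N ^ (-(1:ℝ)/2) : ℝ) : ℂ) *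
    ((h (lam j) : ℂ) * (starRingEnd ℂ) (Ψ j x₀)) with ha
  have hFa : F = fun x => ∑ j, a j * Ψ j x := by
    ext x
    rw [hF, Finset.mul_sum]
    refine Finset.sum_congr rfl fun j _ => ?_
    rw [ha]; ring
  have hnorm : ∑ j, ‖a j‖ ^ 2 = 1 := by
    have h1 : ∀ j, ‖a j‖ ^ 2 = N⁻¹ * ((h (lam j)) ^ 2 * ‖Ψ j x₀‖ ^ 2) := by
      intro j
      have h2 : (N ^ (-(1:ℝ)/2)) ^ 2 = N⁻¹ := by
        rw [← Real.rpow_natCast, ← Real.rpow_mul hNpos.le, ← Real.rpow_neg_one]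
        norm_num
      simp only [ha, norm_mul, Complex.norm_real, RCLike.norm_conj, mul_pow, Real.norm_eq_abs,
        sq_abs]
      rw [h2]
    simp_rw [h1]
    rw [← Finset.mul_sum, ← hN, inv_mul_cancel₀ hN0]
  have hΨc := fun j => (hΨ j).continuous
  have hF2 : ContDiff ℝ 2 F := by
    rw [hFa]
    exact ContDiff.sum fun j _ => contDiff_const.mul (hΨ j)
  have hFp : LatPeriodic d L γ F := by
    intro x i
    rw [hFa]
    simp only [hΨp _ x i]
  have hnc : ∀ z : ℂ, z * (starRingEnd ℂ) z = ((‖z‖ ^ 2 : ℝ) : ℂ) := by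
    intro z; rw [Complex.mul_conj, Complex.normSq_eq_norm_sq]
  have hmass : ∫ x in fund d L γ, ‖F x‖ ^ 2 = 1 := by
    have := aux_orth d L γ hP n Ψ hΨc ho a a
    rw [hFa]
    simp only [hnc, Complex.ofReal_re] at this
    rw [this, ← Complex.ofReal_sum, Complex.ofReal_re, hnorm]
  have hen : ∫ x in fund d L γ, ‖fderiv ℝ F x (EuclideanSpace.single ⟨0, hd⟩ 1)‖ ^ 2 ≤ 2 * E := by
    have h1 := aux_energy d L γ hP F (fun x => ∑ j, (lam j * a j) * Ψ j x) V hF2 hFp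
      (by fun_prop) hV0 ?_ ⟨0, hd⟩
    · refine h1.trans ?_
      have h2 := aux_orth d L γ hP n Ψ hΨc ho a (fun j => lam j * a j)
      rw [hFa, h2]
      simp only [mul_assoc, hnc]
      have h3 : ∑ j, (lam j : ℂ) * ((‖a j‖ ^ 2 : ℝ) : ℂ) = ((∑ j, lam j * ‖a j‖ ^ 2 : ℝ) : ℂ) := by
        push_cast; rfl
      rw [h3, Complex.ofReal_re, ← mul_one (2 * E), ← hnorm, Finset.mul_sum]
      exact Finset.sum_le_sum fun j _ => mul_le_mul_of_nonneg_right (hlam j).2 (sq_nonneg _)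
    · intro x
      rw [hFa, aux_lap_sum d n Ψ hΨ, Finset.mul_sum, ← Finset.sum_neg_distrib,
        ← Finset.sum_add_distrib]
      refine Finset.sum_congr rfl fun j _ => ?_
      have := heq j x
      linear_combination (a j) * this
  have hslab := aux_slab d L γ hP F (hF2.of_le (by norm_num)) hFp ⟨0, hd⟩ (xc ⟨0, hd⟩) ℓ hℓ0
    (by rw [hγ0, mul_one]; exact hℓ1) _ rfl
  rw [hmass] at hslab
  have hFc := hF2.continuous
  have hmono : ∫ x in fund d L γ ∩ torusBall d L γ xc ℓ, ‖F x‖ ^ 2 ≤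
      ∫ x in fund d L γ ∩ {x | ∃ m : ℤ, |x ⟨0, hd⟩ - xc ⟨0, hd⟩ - m * (L * γ ⟨0, hd⟩)| < ℓ},
        ‖F x‖ ^ 2 := by
    refine setIntegral_mono_set ?_ (Eventually.of_forall fun x => sq_nonneg _) ?_
    · exact (aux_int d L γ hP (fun x => ‖F x‖ ^ 2) (by fun_prop)).mono_set Set.inter_subset_left
    · exact (Set.inter_subset_inter_right _ (aux_ball_sub d L γ _ xc ℓ)).eventuallyLE
  have hfin : 2 * (14 * ℓ) ^ 2 *
      (∫ x in fund d L γ, ‖fderiv ℝ F x (EuclideanSpace.single ⟨0, hd⟩ 1)‖ ^ 2) ≤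
      2 * (14 * ℓ) ^ 2 * (2 * E) := mul_le_mul_of_nonneg_left hen (by positivity)
  nlinarith
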